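/- arXiv:2008.02737 — 2 statements merged into one kernel-verified Lean document; each statement's English description precedes it below -/
import Mathlib

section
/- Let p ≥ d, let S* ∈ St(d,p)^n be a first-order critical point of f, and let C be the certificate matrix at S*. Suppose the minimum eigenvalue λ_min of C is negative, with a corresponding eigenvector v = (v_1,…,v_n) ∈ ℝ^{dn}, v_i ∈ ℝ^d. Define S⁺ ∈ St(d,p+1)^n blockwise by S⁺_i = [S*_i; 0] (appending one zero row to each S*_i), and define Ṡ⁺ blockwise by Ṡ⁺_i = [0; v_iᵀ] (the (p+1)×d matrix whose first p rows are zero and whose last row is v_iᵀ). Then: (i) S⁺ is a first-order critical point of f on St(d,p+1)^n; and (ii) Ṡ⁺ is a second-order descent direction from S⁺, i.e., there exists a C² curve γ : ℝ → ℝ^{(p+1)×(dn)} with γ(t) ∈ St(d,p+1)^n for all t, γ(0) = S⁺, γ′(0) = Ṡ⁺, (f∘γ)′(0) = 0 and (f∘γ)″(0) < 0. -/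
open Matrix BigOperators

noncomputable section

/-- `SO(k)`: real special orthogonal `k × k` matrices. -/
def SOset (k : ℕ) : Set (Matrix (Fin k) (Fin k) ℝ) :=
  {Q | Qᵀ * Q = 1 ∧ Q.det = 1}

/-- The Stiefel manifold `St(d,p)`: real `p × d` matrices with orthonormal columns. -/
def StiefelSet (d p : ℕ) : Set (Matrix (Fin p) (Fin d) ℝ) :=
  {Y | Yᵀ * Y = 1}

/-- Assemble an `n`-tuple of `p × d` blocks into a `p × (dn)` matrix. -/
def flatten {n d p : ℕ} (S : Fin n → Matrix (Fin p) (Fin d) ℝ) :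
    Matrix (Fin p) (Fin n × Fin d) ℝ :=
  fun a ib => S ib.1 a ib.2

/-- The `i`-th block column of a `p × (dn)` matrix. -/
def blockCol {n d p : ℕ} (M : Matrix (Fin p) (Fin n × Fin d) ℝ) (i : Fin n) :
    Matrix (Fin p) (Fin d) ℝ :=
  fun a b => M a (i, b)

/-- Membership of all block columns in `St(d,p)`, i.e. `S ∈ St(d,p)^n`. -/
def StProdFeas {n d p : ℕ} (M : Matrix (Fin p) (Fin n × Fin d) ℝ) : Prop :=
  ∀ i : Fin n, blockCol M i ∈ StiefelSet d p

/-- The connection Laplacian of the measurements `(E, κ, Rbar)`. -/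
def connLap {n d : ℕ} (E : Finset (Fin n × Fin n)) (κ : Fin n × Fin n → ℝ)
    (Rbar : Fin n × Fin n → Matrix (Fin d) (Fin d) ℝ) :
    Matrix (Fin n × Fin d) (Fin n × Fin d) ℝ :=
  fun x y =>
    if x.1 = y.1 then
      (∑ j : Fin n, ((if (x.1, j) ∈ E then κ (x.1, j) else 0) +
          (if (j, x.1) ∈ E then κ (j, x.1) else 0))) *
        (if x.2 = y.2 then (1 : ℝ) else 0)
    else if (x.1, y.1) ∈ E then -κ (x.1, y.1) * Rbar (x.1, y.1) x.2 y.2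
    else if (y.1, x.1) ∈ E then -κ (y.1, x.1) * Rbar (y.1, x.1) y.2 x.2
    else 0

/-- SDP feasibility: positive semidefinite with identity diagonal `d × d` blocks. -/
def SDPFeasible {n d : ℕ} (Z : Matrix (Fin n × Fin d) (Fin n × Fin d) ℝ) : Prop :=
  Z.PosSemidef ∧ ∀ (i : Fin n) (a b : Fin d), Z (i, a) (i, b) = if a = b then (1 : ℝ) else 0

/-- The objective `f(S) = trace (L Sᵀ S)`. -/
def fObj {n d p : ℕ} (L : Matrix (Fin n × Fin d) (Fin n × Fin d) ℝ)
    (S : Matrix (Fin p) (Fin n × Fin d) ℝ) : ℝ :=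
  (L * (Sᵀ * S)).trace

/-- The `p × d` matrix `P = [I_d ; 0]`. -/
def Pmat (d p : ℕ) : Matrix (Fin p) (Fin d) ℝ :=
  fun a b => if (a : ℕ) = (b : ℕ) then 1 else 0

/-- The projection `Π : SO(p)^n → St(d,p)^n`, as a `p × (dn)` matrix. -/
def bigProj {n d p : ℕ} (Q : Fin n → Matrix (Fin p) (Fin p) ℝ) :
    Matrix (Fin p) (Fin n × Fin d) ℝ :=
  flatten (fun i => Q i * Pmat d p)

/-- First-order criticality of `f` on `St(d,p)^n`: along every (componentwise) `C¹` curve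
through `S` in `St(d,p)^n`, the derivative of `f ∘ γ` vanishes at `0`. -/
def IsCriticalSt {n d p : ℕ} (L : Matrix (Fin n × Fin d) (Fin n × Fin d) ℝ)
    (S : Matrix (Fin p) (Fin n × Fin d) ℝ) : Prop :=
  ∀ γ : ℝ → Matrix (Fin p) (Fin n × Fin d) ℝ,
    (∀ a ib, ContDiff ℝ 1 fun t => γ t a ib) → (∀ t, StProdFeas (γ t)) → γ 0 = S →
    deriv (fun t => fObj L (γ t)) 0 = 0

/-- Second-order criticality of `f` on `St(d,p)^n`. -/
def IsSecondOrderCriticalSt {n d p : ℕ} (L : Matrix (Fin n × Fin d) (Fin n × Fin d) ℝ)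
    (S : Matrix (Fin p) (Fin n × Fin d) ℝ) : Prop :=
  IsCriticalSt L S ∧
  ∀ γ : ℝ → Matrix (Fin p) (Fin n × Fin d) ℝ,
    (∀ a ib, ContDiff ℝ 2 fun t => γ t a ib) → (∀ t, StProdFeas (γ t)) → γ 0 = S →
    0 ≤ iteratedDeriv 2 (fun t => fObj L (γ t)) 0

/-- First-order criticality of the Shonan objective `g = f ∘ Π` on `SO(p)^n`. -/
def IsCriticalSO {n d p : ℕ} (L : Matrix (Fin n × Fin d) (Fin n × Fin d) ℝ)
    (Q : Fin n → Matrix (Fin p) (Fin p) ℝ) : Prop :=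
  ∀ γ : ℝ → (Fin n → Matrix (Fin p) (Fin p) ℝ),
    (∀ i a b, ContDiff ℝ 1 fun t => γ t i a b) → (∀ t i, γ t i ∈ SOset p) → γ 0 = Q →
    deriv (fun t => fObj L (bigProj (γ t))) 0 = 0

/-- `SymBlockDiag`: zero out all entries outside the `n` diagonal `d × d` blocks. -/
def symBlockDiag {n d : ℕ} (M : Matrix (Fin n × Fin d) (Fin n × Fin d) ℝ) :
    Matrix (Fin n × Fin d) (Fin n × Fin d) ℝ :=
  fun x y => if x.1 = y.1 then M x y else 0

/-- The certificate matrix `C = L − (1/2)·SymBlockDiag(L SᵀS + SᵀS L)`. -/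
def certMat {n d p : ℕ} (L : Matrix (Fin n × Fin d) (Fin n × Fin d) ℝ)
    (S : Matrix (Fin p) (Fin n × Fin d) ℝ) :
    Matrix (Fin n × Fin d) (Fin n × Fin d) ℝ :=
  L - (1 / 2 : ℝ) • symBlockDiag (L * (Sᵀ * S) + (Sᵀ * S) * L)

/-- The spectral norm (ℓ² operator norm) of a square real matrix. -/
def specNorm {m : Type*} [Fintype m] [DecidableEq m] (A : Matrix m m ℝ) : ℝ :=
  ‖Matrix.toEuclideanCLM (𝕜 := ℝ) A‖

/-- Squared Frobenius norm. -/
def frobSq {m k : ℕ} (M : Matrix (Fin m) (Fin k) ℝ) : ℝ :=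
  ∑ a, ∑ b, (M a b) ^ 2


/-- Append one zero row at the bottom of a `p × (dn)` matrix (blockwise: `Sᵢ ↦ [Sᵢ ; 0]`). -/
def bigPad {n d p : ℕ} (M : Matrix (Fin p) (Fin n × Fin d) ℝ) :
    Matrix (Fin (p + 1)) (Fin n × Fin d) ℝ :=
  fun a ib => if h : (a : ℕ) < p then M ⟨a, h⟩ ib else 0

/-- The `(p+1) × (dn)` matrix whose first `p` rows vanish and whose last row is `v`
(blockwise: `Ṡ⁺ᵢ = [0 ; vᵢᵀ]`). -/
def lastRowMat {n d : ℕ} (p : ℕ) (v : Fin n × Fin d → ℝ) :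
    Matrix (Fin (p + 1)) (Fin n × Fin d) ℝ :=
  fun a ib => if (a : ℕ) = p then v ib else 0

/-- The bilinear form `⟨M, N⟩_L = trace (L Mᵀ N)`, whose quadratic form is `fObj L`. -/
def fPair {n d p : ℕ} (L : Matrix (Fin n × Fin d) (Fin n × Fin d) ℝ)
    (M N : Matrix (Fin p) (Fin n × Fin d) ℝ) : ℝ :=
  (L * (Mᵀ * N)).trace

theorem fPair_eq_sum {n d p : ℕ} (L : Matrix (Fin n × Fin d) (Fin n × Fin d) ℝ)
    (M N : Matrix (Fin p) (Fin n × Fin d) ℝ) :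
    fPair L M N = ∑ x, ∑ y, L x y * ∑ a, M a y * N a x := by
  simp [fPair, Matrix.trace, Matrix.mul_apply, Matrix.transpose_apply]

theorem hasDerivAt_fPair {n d p : ℕ} (L : Matrix (Fin n × Fin d) (Fin n × Fin d) ℝ)
    {M N : ℝ → Matrix (Fin p) (Fin n × Fin d) ℝ} {M' N' : Matrix (Fin p) (Fin n × Fin d) ℝ}
    {t : ℝ} (hM : ∀ a x, HasDerivAt (fun s => M s a x) (M' a x) t)
    (hN : ∀ a x, HasDerivAt (fun s => N s a x) (N' a x) t) :
    HasDerivAt (fun s => fPair L (M s) (N s)) (fPair L M' (N t) + fPair L (M t) N') t := by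
  simp only [fPair_eq_sum, ← Finset.sum_add_distrib, ← mul_add]
  exact HasDerivAt.fun_sum fun x _ => HasDerivAt.fun_sum fun y _ =>
    (HasDerivAt.fun_sum fun a _ => (hM a y).mul (hN a x)).const_mul _

theorem fPair_comm {n d p : ℕ} {L : Matrix (Fin n × Fin d) (Fin n × Fin d) ℝ} (hL : L.IsSymm)
    (M N : Matrix (Fin p) (Fin n × Fin d) ℝ) : fPair L M N = fPair L N M := by
  rw [fPair, fPair, ← Matrix.trace_transpose, Matrix.transpose_mul, Matrix.transpose_mul,
    Matrix.transpose_transpose, hL.eq, Matrix.trace_mul_comm]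

theorem connLap_isSymm {n d : ℕ} {E : Finset (Fin n × Fin n)} (hE : ∀ e ∈ E, e.1 < e.2)
    (κ : Fin n × Fin n → ℝ) (Rbar : Fin n × Fin n → Matrix (Fin d) (Fin d) ℝ) :
    (connLap E κ Rbar).IsSymm := by
  ext ⟨i, a⟩ ⟨j, b⟩
  simp only [Matrix.transpose_apply, connLap]
  rcases eq_or_ne i j with rfl | hij
  · simp [eq_comm]
  · simp only [if_neg hij, if_neg hij.symm]
    by_cases h1 : (i, j) ∈ E
    · have h2 : (j, i) ∉ E := fun h2 => lt_asymm (hE _ h1) (hE _ h2)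
      simp [h1, h2]
    · simp [h1]

/-- Left multiplication of the `i`-th block of `S` by `A i`. -/
def blockMul {n d p : ℕ} (A : Fin n → Matrix (Fin p) (Fin p) ℝ)
    (S : Matrix (Fin p) (Fin n × Fin d) ℝ) : Matrix (Fin p) (Fin n × Fin d) ℝ :=
  flatten fun i => A i * blockCol S i

/-- The curve `t ↦ exp (t Aᵢ) Sᵢ`, blockwise. -/
def expCurve {n d p : ℕ} (A : Fin n → Matrix (Fin p) (Fin p) ℝ)
    (S : Matrix (Fin p) (Fin n × Fin d) ℝ) (t : ℝ) : Matrix (Fin p) (Fin n × Fin d) ℝ :=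
  blockMul (fun i => NormedSpace.exp (t • A i)) S

theorem expCurve_zero {n d p : ℕ} (A : Fin n → Matrix (Fin p) (Fin p) ℝ)
    (S : Matrix (Fin p) (Fin n × Fin d) ℝ) : expCurve A S 0 = S := by
  ext a ⟨i, b⟩
  simp [expCurve, blockMul, flatten, blockCol]

open scoped Matrix.Norms.Operator in
theorem hasDerivAt_exp_smul_apply {p : ℕ} (A : Matrix (Fin p) (Fin p) ℝ) (t : ℝ) (a b : Fin p) :
    HasDerivAt (fun s : ℝ => NormedSpace.exp (s • A) a b) ((NormedSpace.exp (t • A) * A) a b) t :=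
  hasDerivAt_pi.1 (hasDerivAt_pi.1 (hasDerivAt_exp_smul_const (𝕂 := ℝ) A t) a) b

theorem hasDerivAt_expCurve {n d p : ℕ} (A : Fin n → Matrix (Fin p) (Fin p) ℝ)
    (S : Matrix (Fin p) (Fin n × Fin d) ℝ) (a : Fin p) (x : Fin n × Fin d) (t : ℝ) :
    HasDerivAt (fun s => expCurve A S s a x) (expCurve A (blockMul A S) t a x) t := by
  obtain ⟨i, b⟩ := x
  have h : expCurve A (blockMul A S) t a (i, b) =
      ∑ k, (NormedSpace.exp (t • A i) * A i) a k * S k (i, b) := by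
    change (NormedSpace.exp (t • A i) * (A i * blockCol S i)) a b = _
    rw [← Matrix.mul_assoc, Matrix.mul_apply]
    rfl
  rw [h]
  change HasDerivAt (fun s => ∑ k, NormedSpace.exp (s • A i) a k * S k (i, b)) _ t
  exact HasDerivAt.fun_sum fun k _ => (hasDerivAt_exp_smul_apply (A i) t a k).mul_const _

theorem contDiff_expCurve {n d p : ℕ} (A : Fin n → Matrix (Fin p) (Fin p) ℝ)
    (S : Matrix (Fin p) (Fin n × Fin d) ℝ) (a : Fin p) (x : Fin n × Fin d) (k : ℕ) :
    ContDiff ℝ k fun s => expCurve A S s a x := by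
  induction k generalizing S with
  | zero =>
    exact contDiff_zero.2 (continuous_iff_continuousAt.2 fun t =>
      (hasDerivAt_expCurve A S a x t).continuousAt)
  | succ k ih =>
    push_cast
    refine contDiff_succ_iff_deriv.2
      ⟨fun t => (hasDerivAt_expCurve A S a x t).differentiableAt, by simp, ?_⟩
    rw [funext fun t => (hasDerivAt_expCurve A S a x t).deriv]
    exact ih _

theorem transpose_exp_mul_exp {p : ℕ} {A : Matrix (Fin p) (Fin p) ℝ} (hA : Aᵀ = -A) (t : ℝ) :
    (NormedSpace.exp (t • A))ᵀ * NormedSpace.exp (t • A) = 1 := by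
  rw [← Matrix.exp_transpose, Matrix.transpose_smul, hA, smul_neg,
    ← Matrix.exp_add_of_commute _ _ (Commute.refl (t • A)).neg_left, neg_add_cancel,
    NormedSpace.exp_zero]

theorem stProdFeas_expCurve {n d p : ℕ} {A : Fin n → Matrix (Fin p) (Fin p) ℝ}
    (hA : ∀ i, (A i)ᵀ = -A i) {S : Matrix (Fin p) (Fin n × Fin d) ℝ} (hS : StProdFeas S) (t : ℝ) :
    StProdFeas (expCurve A S t) := by
  intro i
  have h : blockCol (expCurve A S t) i = NormedSpace.exp (t • A i) * blockCol S i := rfl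
  have hSi : (blockCol S i)ᵀ * blockCol S i = 1 := hS i
  change (blockCol (expCurve A S t) i)ᵀ * blockCol (expCurve A S t) i = 1
  rw [h, Matrix.transpose_mul, Matrix.mul_assoc, ← Matrix.mul_assoc _ᵀ (NormedSpace.exp _),
    transpose_exp_mul_exp (hA i), Matrix.one_mul, hSi]

/-- A skew-symmetric generator of the tangent vector `Y` to the Stiefel manifold at `S`. -/
def skewGen {d p : ℕ} (S Y : Matrix (Fin p) (Fin d) ℝ) : Matrix (Fin p) (Fin p) ℝ :=
  Y * Sᵀ - S * Yᵀ - S * (Sᵀ * Y) * Sᵀ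

theorem skewGen_mul {d p : ℕ} {S Y : Matrix (Fin p) (Fin d) ℝ} (hS : Sᵀ * S = 1)
    (hY : Sᵀ * Y + Yᵀ * S = 0) : skewGen S Y * S = Y := by
  have h : Yᵀ * S = -(Sᵀ * Y) := eq_neg_of_add_eq_zero_right hY
  simp only [skewGen, Matrix.sub_mul, Matrix.mul_assoc, hS, h, Matrix.mul_one, Matrix.mul_neg]
  abel

theorem skewGen_transpose {d p : ℕ} {S Y : Matrix (Fin p) (Fin d) ℝ}
    (hY : Sᵀ * Y + Yᵀ * S = 0) : (skewGen S Y)ᵀ = -skewGen S Y := by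
  have h : Yᵀ * S = -(Sᵀ * Y) := eq_neg_of_add_eq_zero_right hY
  have h' : S * (Yᵀ * (S * Sᵀ)) = -(S * (Sᵀ * (Y * Sᵀ))) := by
    rw [← Matrix.mul_assoc Yᵀ, h, Matrix.neg_mul, Matrix.mul_neg, Matrix.mul_assoc]
  simp only [skewGen, Matrix.transpose_sub, Matrix.transpose_mul, Matrix.transpose_transpose,
    Matrix.mul_assoc, h']
  abel

/-- At a first-order critical point, the differential of `fObj L` vanishes on tangent vectors. -/
theorem IsCriticalSt.fPair_add_eq_zero {n d p : ℕ}
    {L : Matrix (Fin n × Fin d) (Fin n × Fin d) ℝ} {S Y : Matrix (Fin p) (Fin n × Fin d) ℝ}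
    (hcrit : IsCriticalSt L S) (hS : StProdFeas S)
    (hY : ∀ i, (blockCol S i)ᵀ * blockCol Y i + (blockCol Y i)ᵀ * blockCol S i = 0) :
    fPair L Y S + fPair L S Y = 0 := by
  set A : Fin n → Matrix (Fin p) (Fin p) ℝ := fun i => skewGen (blockCol S i) (blockCol Y i)
  have hAS : blockMul A S = Y := by
    ext a ⟨i, b⟩
    exact congrFun (congrFun (skewGen_mul (hS i) (hY i)) a) b
  have h := hcrit (expCurve A S) (fun a x => contDiff_expCurve A S a x 1)
    (stProdFeas_expCurve (fun i => skewGen_transpose (hY i)) hS) (expCurve_zero A S)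
  have h' := (hasDerivAt_fPair L (fun a x => hasDerivAt_expCurve A S a x 0)
    (fun a x => hasDerivAt_expCurve A S a x 0)).deriv
  rw [expCurve_zero, expCurve_zero, hAS] at h'
  exact h'.symm.trans h

theorem StProdFeas.sum_mul {n d p : ℕ} {M : Matrix (Fin p) (Fin n × Fin d) ℝ}
    (hM : StProdFeas M) (i : Fin n) (b c : Fin d) :
    ∑ a, M a (i, b) * M a (i, c) = (1 : Matrix (Fin d) (Fin d) ℝ) b c := by
  rw [← show (blockCol M i)ᵀ * blockCol M i = 1 from hM i]
  rfl

theorem bigPad_castSucc {n d p : ℕ} (M : Matrix (Fin p) (Fin n × Fin d) ℝ) (a : Fin p)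
    (x : Fin n × Fin d) : bigPad M a.castSucc x = M a x := by
  simp [bigPad]

theorem bigPad_last {n d p : ℕ} (M : Matrix (Fin p) (Fin n × Fin d) ℝ)
    (x : Fin n × Fin d) : bigPad M (Fin.last p) x = 0 := by
  simp [bigPad]

theorem stProdFeas_bigPad {n d p : ℕ} {M : Matrix (Fin p) (Fin n × Fin d) ℝ}
    (hM : StProdFeas M) : StProdFeas (bigPad M) := by
  intro i
  change (blockCol (bigPad M) i)ᵀ * blockCol (bigPad M) i = 1
  ext b c
  rw [← hM.sum_mul i b c]
  simp [Matrix.mul_apply, blockCol, Fin.sum_univ_castSucc, bigPad_castSucc, bigPad_last]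

/-- Appending zero rows preserves first-order criticality. -/
theorem IsCriticalSt.bigPad {n d p : ℕ} {L : Matrix (Fin n × Fin d) (Fin n × Fin d) ℝ}
    {S : Matrix (Fin p) (Fin n × Fin d) ℝ} (hcrit : IsCriticalSt L S) (hS : StProdFeas S) :
    IsCriticalSt L (bigPad S) := by
  intro γ hγ hfeas h0
  set X : Matrix (Fin (p + 1)) (Fin n × Fin d) ℝ := fun a x => deriv (fun t => γ t a x) 0
  have hX : ∀ a x, HasDerivAt (fun t => γ t a x) (X a x) 0 := fun a x =>
    ((hγ a x).differentiable (by simp) 0).hasDerivAt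
  set Y : Matrix (Fin p) (Fin n × Fin d) ℝ := fun a x => X a.castSucc x
  have hY : ∀ i, (blockCol S i)ᵀ * blockCol Y i + (blockCol Y i)ᵀ * blockCol S i = 0 := by
    intro i
    ext b c
    have h1 : HasDerivAt (fun t => ∑ a, γ t a (i, b) * γ t a (i, c))
        (∑ a, (X a (i, b) * γ 0 a (i, c) + γ 0 a (i, b) * X a (i, c))) 0 :=
      HasDerivAt.fun_sum fun a _ => (hX a (i, b)).mul (hX a (i, c))
    rw [funext fun t => (hfeas t).sum_mul i b c] at h1
    have h2 := h1.unique (hasDerivAt_const _ _)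
    rw [h0, Fin.sum_univ_castSucc] at h2
    simp only [bigPad_castSucc, bigPad_last, mul_zero, zero_mul, add_zero,
      Finset.sum_add_distrib] at h2
    rw [add_comm] at h2
    exact h2
  have h := hcrit.fPair_add_eq_zero hS hY
  have h' := (hasDerivAt_fPair L hX hX).deriv
  rw [h0] at h'
  refine h'.trans (Eq.trans ?_ h)
  rw [fPair_eq_sum L Y, fPair_eq_sum L S]
  simp [fPair_eq_sum, Fin.sum_univ_castSucc, bigPad_castSucc, bigPad_last, Y]

theorem iteratedDeriv_two_fObj_expCurve {n d p : ℕ}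
    {L : Matrix (Fin n × Fin d) (Fin n × Fin d) ℝ} (hL : L.IsSymm)
    (A : Fin n → Matrix (Fin p) (Fin p) ℝ) (S : Matrix (Fin p) (Fin n × Fin d) ℝ) :
    iteratedDeriv 2 (fun t => fObj L (expCurve A S t)) 0 =
      2 * (fPair L (blockMul A S) (blockMul A S) + fPair L (blockMul A (blockMul A S)) S) := by
  have h1 : deriv (fun t => fObj L (expCurve A S t)) =
      fun t => 2 * fPair L (expCurve A (blockMul A S) t) (expCurve A S t) := by
    funext t
    have h := (hasDerivAt_fPair L (fun a x => hasDerivAt_expCurve A S a x t)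
      (fun a x => hasDerivAt_expCurve A S a x t)).deriv
    rw [fPair_comm hL (expCurve A S t), ← two_mul] at h
    exact h
  have h2 := ((hasDerivAt_fPair L (fun a x => hasDerivAt_expCurve A (blockMul A S) a x 0)
      (fun a x => hasDerivAt_expCurve A S a x 0)).const_mul 2).deriv
  rw [iteratedDeriv_succ, iteratedDeriv_one, h1, h2]
  simp only [expCurve_zero]
  ring

theorem lastRowMat_castSucc {n d p : ℕ} (v : Fin n × Fin d → ℝ) (a : Fin p)
    (x : Fin n × Fin d) : lastRowMat p v a.castSucc x = 0 := by
  simp [lastRowMat, a.isLt.ne]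

theorem lastRowMat_last {n d p : ℕ} (v : Fin n × Fin d → ℝ)
    (x : Fin n × Fin d) : lastRowMat p v (Fin.last p) x = v x := by
  simp [lastRowMat]

theorem bigPad_transpose_mul_lastRowMat {n d p : ℕ} (S : Matrix (Fin p) (Fin n × Fin d) ℝ)
    (v : Fin n × Fin d → ℝ) (i : Fin n) :
    (blockCol (bigPad S) i)ᵀ * blockCol (lastRowMat p v) i = 0 := by
  ext b c
  simp [Matrix.mul_apply, blockCol, Fin.sum_univ_castSucc, bigPad_last, lastRowMat_castSucc]

/-- The quadratic form of the certificate matrix. -/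
theorem dotProduct_certMat_mulVec {n d p : ℕ} {L : Matrix (Fin n × Fin d) (Fin n × Fin d) ℝ}
    (hL : L.IsSymm) (S : Matrix (Fin p) (Fin n × Fin d) ℝ) (v : Fin n × Fin d → ℝ) :
    v ⬝ᵥ certMat L S *ᵥ v =
      v ⬝ᵥ L *ᵥ v - v ⬝ᵥ symBlockDiag (L * (Sᵀ * S)) *ᵥ v := by
  have h : symBlockDiag (L * (Sᵀ * S) + Sᵀ * S * L) =
      symBlockDiag (L * (Sᵀ * S)) + (symBlockDiag (L * (Sᵀ * S)))ᵀ := by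
    have hT : Sᵀ * S * L = (L * (Sᵀ * S))ᵀ := by
      simp [Matrix.transpose_mul, hL.eq, Matrix.mul_assoc]
    rw [hT]
    ext x y
    by_cases hxy : x.1 = y.1
    · simp only [symBlockDiag, Matrix.add_apply, Matrix.transpose_apply, if_pos hxy,
        if_pos hxy.symm]
    · simp [symBlockDiag, hxy, Ne.symm hxy]
  rw [certMat, h, Matrix.sub_mulVec, Matrix.smul_mulVec, Matrix.add_mulVec, dotProduct_sub,
    dotProduct_smul, dotProduct_add, Matrix.mulVec_transpose, dotProduct_comm v (v ᵥ* _),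
    ← Matrix.dotProduct_mulVec, smul_eq_mul]
  ring

theorem fPair_lastRowMat {n d : ℕ} (p : ℕ) {L : Matrix (Fin n × Fin d) (Fin n × Fin d) ℝ}
    (v : Fin n × Fin d → ℝ) :
    fPair L (lastRowMat p v) (lastRowMat p v) = v ⬝ᵥ L *ᵥ v := by
  simp only [fPair_eq_sum, Fin.sum_univ_castSucc, lastRowMat_castSucc, lastRowMat_last, mul_zero,
    Finset.sum_const_zero, zero_add, dotProduct, Matrix.mulVec, Finset.mul_sum]
  exact Finset.sum_congr rfl fun x _ => Finset.sum_congr rfl fun y _ => by ring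

theorem skewGen_mul_of_transpose_mul_eq_zero {d p : ℕ} {S Y : Matrix (Fin p) (Fin d) ℝ}
    (hY : Sᵀ * Y = 0) : skewGen S Y * Y = -(S * (Yᵀ * Y)) := by
  simp [skewGen, Matrix.sub_mul, Matrix.mul_assoc, hY]

theorem lastRowMat_transpose_mul {n d p : ℕ} (v : Fin n × Fin d → ℝ) (i : Fin n) :
    (blockCol (lastRowMat p v) i)ᵀ * blockCol (lastRowMat p v) i =
      Matrix.of fun b c => v (i, b) * v (i, c) := by
  ext b c
  simp [Matrix.mul_apply, blockCol, Fin.sum_univ_castSucc, lastRowMat_castSucc, lastRowMat_last]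

theorem symBlockDiag_mulVec_apply {n d : ℕ} (M : Matrix (Fin n × Fin d) (Fin n × Fin d) ℝ)
    (v : Fin n × Fin d → ℝ) (i : Fin n) (b : Fin d) :
    (symBlockDiag M *ᵥ v) (i, b) = ∑ c, M (i, b) (i, c) * v (i, c) := by
  simp [Matrix.mulVec, dotProduct, symBlockDiag, Fintype.sum_prod_type_right]

theorem fPair_bigPad_mul {n d p : ℕ} {L : Matrix (Fin n × Fin d) (Fin n × Fin d) ℝ}
    (hL : L.IsSymm) (S : Matrix (Fin p) (Fin n × Fin d) ℝ) (v : Fin n × Fin d → ℝ) :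
    fPair L (flatten fun i => -(blockCol (bigPad S) i *
        Matrix.of fun b c : Fin d => v (i, b) * v (i, c))) (bigPad S) =
      -(v ⬝ᵥ symBlockDiag (L * (Sᵀ * S)) *ᵥ v) := by
  rw [fPair_comm hL, fPair_eq_sum, dotProduct, ← Finset.sum_neg_distrib]
  refine Finset.sum_congr rfl fun ⟨i, b⟩ _ => ?_
  simp only [symBlockDiag_mulVec_apply, Fin.sum_univ_castSucc, bigPad_castSucc, bigPad_last,
    flatten, blockCol, Matrix.neg_apply, Matrix.mul_apply, Matrix.transpose_apply,
    Matrix.of_apply, zero_mul, Finset.sum_mul, Finset.mul_sum, mul_neg,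
    Finset.sum_neg_distrib, Finset.sum_const_zero, add_zero]
  congr 1
  rw [Finset.sum_comm (s := (Finset.univ : Finset (Fin d)))]
  refine Finset.sum_congr rfl fun z _ => ?_
  rw [Finset.sum_comm]
  exact Finset.sum_congr rfl fun c _ => Finset.sum_congr rfl fun a _ => by ring

/-- Saddle escape: lifting a first-order critical point with a negative
certificate eigenvalue yields a first-order critical point one level up, together with a
second-order descent direction. -/
theorem statement5 {n d p : ℕ} (hn : 1 ≤ n) (hd : 1 ≤ d) (hdp : d ≤ p)
    (E : Finset (Fin n × Fin n)) (hE : ∀ e ∈ E, e.1 < e.2)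
    (κ : Fin n × Fin n → ℝ) (hκ : ∀ e ∈ E, 0 ≤ κ e)
    (Rbar : Fin n × Fin n → Matrix (Fin d) (Fin d) ℝ)
    (hRbar : ∀ e ∈ E, Rbar e ∈ SOset d)
    (Sstar : Matrix (Fin p) (Fin n × Fin d) ℝ) (hfeas : StProdFeas Sstar)
    (hcrit : IsCriticalSt (connLap E κ Rbar) Sstar)
    (lam : ℝ) (hneg : lam < 0) (v : Fin n × Fin d → ℝ) (hv : v ≠ 0)
    (heig : certMat (connLap E κ Rbar) Sstar *ᵥ v = lam • v)
    (hmin : ∀ (μ : ℝ) (w : Fin n × Fin d → ℝ), w ≠ 0 →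
      certMat (connLap E κ Rbar) Sstar *ᵥ w = μ • w → lam ≤ μ) :
    IsCriticalSt (connLap E κ Rbar) (bigPad Sstar) ∧
    ∃ γ : ℝ → Matrix (Fin (p + 1)) (Fin n × Fin d) ℝ,
      (∀ a ib, ContDiff ℝ 2 fun t => γ t a ib) ∧
      (∀ t, StProdFeas (γ t)) ∧
      γ 0 = bigPad Sstar ∧
      (∀ a ib, deriv (fun t => γ t a ib) 0 = lastRowMat p v a ib) ∧
      deriv (fun t => fObj (connLap E κ Rbar) (γ t)) 0 = 0 ∧
      iteratedDeriv 2 (fun t => fObj (connLap E κ Rbar) (γ t)) 0 < 0 := by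
  have hL := connLap_isSymm hE κ Rbar
  set L := connLap E κ Rbar
  have hpad := hcrit.bigPad hfeas
  have hpfeas := stProdFeas_bigPad hfeas
  have horth := bigPad_transpose_mul_lastRowMat Sstar v
  have htan : ∀ i, (blockCol (bigPad Sstar) i)ᵀ * blockCol (lastRowMat p v) i +
      (blockCol (lastRowMat p v) i)ᵀ * blockCol (bigPad Sstar) i = 0 := by
    intro i
    have h := congrArg Matrix.transpose (horth i)
    rw [Matrix.transpose_mul, Matrix.transpose_transpose, Matrix.transpose_zero] at h
    rw [horth i, h, add_zero]
  set A : Fin n → Matrix (Fin (p + 1)) (Fin (p + 1)) ℝ := fun i =>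
    skewGen (blockCol (bigPad Sstar) i) (blockCol (lastRowMat p v) i)
  have hA1 : blockMul A (bigPad Sstar) = lastRowMat p v := by
    ext a ⟨i, b⟩
    exact congrFun (congrFun (skewGen_mul (hpfeas i) (htan i)) a) b
  have hA2 : blockMul A (lastRowMat p v) = flatten fun i => -(blockCol (bigPad Sstar) i *
      Matrix.of fun b c : Fin d => v (i, b) * v (i, c)) := by
    ext a ⟨i, b⟩
    rw [flatten, ← lastRowMat_transpose_mul (p := p),
      ← skewGen_mul_of_transpose_mul_eq_zero (horth i)]
    rfl
  have hC2 := fun a x => contDiff_expCurve A (bigPad Sstar) a x 2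
  have hst := stProdFeas_expCurve (fun i => skewGen_transpose (htan i)) hpfeas
  have h0 := expCurve_zero A (bigPad Sstar)
  refine ⟨hpad, expCurve A (bigPad Sstar), hC2, hst, h0, fun a x => ?_,
    hpad _ (fun a x => contDiff_expCurve A _ a x 1) hst h0, ?_⟩
  · rw [(hasDerivAt_expCurve A (bigPad Sstar) a x 0).deriv, expCurve_zero, hA1]
  · rw [iteratedDeriv_two_fObj_expCurve hL, hA1, hA2, fPair_lastRowMat, fPair_bigPad_mul hL,
      ← sub_eq_add_neg, ← dotProduct_certMat_mulVec hL, heig, dotProduct_smul, smul_eq_mul]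
    have hvv : 0 < v ⬝ᵥ v := by
      simpa using Matrix.dotProduct_star_self_pos_iff.2 hv
    nlinarith
end
end

section
/- Let p ≥ d, let Q* ∈ SO(p)^n be a first-order critical point of the Shonan objective g on SO(p)^n, and let C be the certificate matrix at S* = Π(Q*). Suppose the minimum eigenvalue λ_min of C is negative, with a corresponding eigenvector v = (v_1,…,v_n) ∈ ℝ^{dn}, v_i ∈ ℝ^d. Define Q⁺ ∈ SO(p+1)^n blockwise by Q⁺_i = blockdiag(Q*_i, 1), and define Q̇⁺ blockwise by Q̇⁺_i = Q⁺_i·A_i, where A_i is the (p+1)×(p+1) skew-symmetric matrix whose top-left p×p block is 0, whose last column (above the diagonal entry) is −ṽ_i and whose last row is ṽ_iᵀ, with ṽ_i ∈ ℝ^p the vector v_i padded with p−d trailing zeros. Then: (i) Q⁺ is a first-order critical point of the Shonan objective g on SO(p+1)^n (with the same data, in dimension p+1); and (ii) Q̇⁺ is a second-order descent direction from Q⁺, i.e., there exists a C² curve γ : ℝ → (ℝ^{(p+1)×(p+1)})^n with γ(t) ∈ SO(p+1)^n for all t, γ(0) = Q⁺, γ′(0) = Q̇⁺, (g∘γ)′(0)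 = 0 and (g∘γ)″(0) < 0. -/
open Matrix BigOperators

noncomputable section

/-- `blockdiag(Q, 1) ∈ SO(p+1)` from `Q ∈ SO(p)`. -/
def padRot {p : ℕ} (Q : Matrix (Fin p) (Fin p) ℝ) :
    Matrix (Fin (p + 1)) (Fin (p + 1)) ℝ :=
  fun a b =>
    if ha : (a : ℕ) < p then
      if hb : (b : ℕ) < p then Q ⟨a, ha⟩ ⟨b, hb⟩ else 0
    else if (b : ℕ) < p then 0 else 1

/-- The `(p+1) × (p+1)` skew-symmetric matrix with zero top-left `p × p` block, last column
`−w` (above the diagonal) and last row `wᵀ`. -/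
def skewFromVec {p : ℕ} (w : Fin p → ℝ) :
    Matrix (Fin (p + 1)) (Fin (p + 1)) ℝ :=
  fun a b =>
    if ha : (a : ℕ) < p then
      if (b : ℕ) < p then 0 else -(w ⟨a, ha⟩)
    else if hb : (b : ℕ) < p then w ⟨b, hb⟩ else 0

/-- Pad a vector in `ℝ^d` with `p − d` trailing zeros to get a vector in `ℝ^p`. -/
def padVec {d : ℕ} (p : ℕ) (u : Fin d → ℝ) : Fin p → ℝ :=
  fun a => if h : (a : ℕ) < d then u ⟨a, h⟩ else 0

section SpecialOrthogonal

open scoped Matrix.Norms.Operator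

lemma contDiff_exp_smul_entry {k : ℕ} (A : Matrix (Fin k) (Fin k) ℝ) (m : WithTop ℕ∞)
    (a b : Fin k) : ContDiff ℝ m fun t : ℝ => NormedSpace.exp (t • A) a b := by
  have h : ContDiff ℝ m fun t : ℝ => NormedSpace.exp (t • A) := by
    have he : ContDiff ℝ m (NormedSpace.exp : Matrix (Fin k) (Fin k) ℝ → _) :=
      contDiff_iff_contDiffAt.2 fun x => (NormedSpace.exp_analytic (𝕂 := ℝ) x).contDiffAt
    exact he.comp (contDiff_id.smul contDiff_const)
  exact (LinearMap.toContinuousLinearMap (Matrix.entryLinearMap ℝ ℝ a b)).contDiff.comp h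

lemma hasDerivAt_exp_smul_entry {k : ℕ} (A : Matrix (Fin k) (Fin k) ℝ) (a b : Fin k) :
    HasDerivAt (fun t : ℝ => NormedSpace.exp (t • A) a b) (A a b) 0 := by
  have h := hasDerivAt_exp_smul_const (𝕂 := ℝ) A 0
  rw [zero_smul, NormedSpace.exp_zero, one_mul] at h
  exact (LinearMap.toContinuousLinearMap
    (Matrix.entryLinearMap ℝ ℝ a b)).hasFDerivAt.comp_hasDerivAt 0 h

lemma exp_mem_SOset {k : ℕ} {A : Matrix (Fin k) (Fin k) ℝ} (hA : Aᵀ = -A) :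
    NormedSpace.exp A ∈ SOset k := by
  have orth : ∀ B : Matrix (Fin k) (Fin k) ℝ, Bᵀ = -B →
      (NormedSpace.exp B)ᵀ * NormedSpace.exp B = 1 := fun B hB => by
    rw [← Matrix.exp_transpose, hB,
      ← Matrix.exp_add_of_commute _ _ (Commute.neg_left (Commute.refl B))]
    simp
  refine ⟨orth A hA, ?_⟩
  have half : NormedSpace.exp A =
      NormedSpace.exp ((1 / 2 : ℝ) • A) * NormedSpace.exp ((1 / 2 : ℝ) • A) := by
    rw [← Matrix.exp_add_of_commute _ _ (Commute.refl _), ← add_smul]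
    norm_num
  have := congrArg Matrix.det (orth ((1 / 2 : ℝ) • A) (by simp [hA]))
  rw [half, Matrix.det_mul]
  simpa using this

end SpecialOrthogonal

lemma SOset_mul_mem {k : ℕ} {Q R : Matrix (Fin k) (Fin k) ℝ} (hQ : Q ∈ SOset k)
    (hR : R ∈ SOset k) : Q * R ∈ SOset k := by
  refine ⟨?_, by rw [Matrix.det_mul, hQ.2, hR.2, one_mul]⟩
  rw [Matrix.transpose_mul, Matrix.mul_assoc, ← Matrix.mul_assoc Qᵀ, hQ.1, Matrix.one_mul, hR.1]

/-- The curve `t ↦ (Q_i exp (t A_i))_i`. -/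
def rotCurve {n k : ℕ} (Q A : Fin n → Matrix (Fin k) (Fin k) ℝ) (t : ℝ) :
    Fin n → Matrix (Fin k) (Fin k) ℝ :=
  fun i => Q i * NormedSpace.exp (t • A i)

lemma rotCurve_zero {n k : ℕ} (Q A : Fin n → Matrix (Fin k) (Fin k) ℝ) :
    rotCurve Q A 0 = Q := by
  ext1 i
  simp [rotCurve]

lemma contDiff_rotCurve {n k : ℕ} (Q A : Fin n → Matrix (Fin k) (Fin k) ℝ) (m : WithTop ℕ∞)
    (i : Fin n) (a b : Fin k) : ContDiff ℝ m fun t => rotCurve Q A t i a b := by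
  simp only [rotCurve, Matrix.mul_apply]
  exact ContDiff.sum fun c _ => contDiff_const.mul (contDiff_exp_smul_entry _ _ _ _)

lemma hasDerivAt_rotCurve {n k : ℕ} (Q A : Fin n → Matrix (Fin k) (Fin k) ℝ)
    (i : Fin n) (a b : Fin k) :
    HasDerivAt (fun t => rotCurve Q A t i a b) ((Q i * A i) a b) 0 := by
  simp only [rotCurve, Matrix.mul_apply]
  exact HasDerivAt.fun_sum fun c _ => (hasDerivAt_exp_smul_entry _ _ _).const_mul _

lemma rotCurve_mem {n k : ℕ} {Q A : Fin n → Matrix (Fin k) (Fin k) ℝ}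
    (hQ : ∀ i, Q i ∈ SOset k) (hA : ∀ i, (A i)ᵀ = -A i) (t : ℝ) (i : Fin n) :
    rotCurve Q A t i ∈ SOset k :=
  SOset_mul_mem (hQ i) (exp_mem_SOset (by simp [hA i]))

lemma fObj_eq_sum {n d p : ℕ} (L : Matrix (Fin n × Fin d) (Fin n × Fin d) ℝ)
    (S : Matrix (Fin p) (Fin n × Fin d) ℝ) :
    fObj L S = ∑ x, ∑ y, ∑ a, L x y * (S a y * S a x) := by
  simp [fObj, Matrix.trace, Matrix.mul_apply, Finset.mul_sum]

lemma hasDerivAt_fObj {n d p : ℕ} {L : Matrix (Fin n × Fin d) (Fin n × Fin d) ℝ}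
    (hL : Lᵀ = L) {T : ℝ → Matrix (Fin p) (Fin n × Fin d) ℝ}
    {T' : Matrix (Fin p) (Fin n × Fin d) ℝ} {t : ℝ}
    (hT : ∀ a x, HasDerivAt (fun s => T s a x) (T' a x) t) :
    HasDerivAt (fun s => fObj L (T s)) (2 * ((T t * L)ᵀ * T').trace) t := by
  simp only [fObj_eq_sum]
  have h : HasDerivAt (fun s => ∑ x, ∑ y, ∑ a, L x y * (T s a y * T s a x))
      (∑ x, ∑ y, ∑ a, L x y * (T' a y * T t a x + T t a y * T' a x)) t :=
    HasDerivAt.fun_sum fun x _ => HasDerivAt.fun_sum fun y _ => HasDerivAt.fun_sum fun a _ =>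
      ((hT a y).mul (hT a x)).const_mul _
  convert h using 1
  simp only [mul_add, Finset.sum_add_distrib]
  have e : ∑ x, ∑ y, ∑ a, L x y * (T t a y * T' a x) = ((T t * L)ᵀ * T').trace := by
    rw [Matrix.transpose_mul, hL]
    simp only [Matrix.trace, Matrix.mul_apply, Matrix.diag_apply, Matrix.transpose_apply,
      Finset.sum_mul]
    refine Finset.sum_congr rfl fun x _ => ?_
    rw [Finset.sum_comm]
    simp only [mul_assoc]
  have e' : ∑ x, ∑ y, ∑ a, L x y * (T' a y * T t a x) =
      ∑ x, ∑ y, ∑ a, L x y * (T t a y * T' a x) := by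
    rw [Finset.sum_comm]
    refine Finset.sum_congr rfl fun x _ => Finset.sum_congr rfl fun y _ =>
      Finset.sum_congr rfl fun a _ => ?_
    rw [show L y x = L x y from congrFun (congrFun hL x) y]
    ring
  rw [e', e, two_mul]

lemma iteratedDeriv_two_mul_of_eq_zero {u w : ℝ → ℝ} {t : ℝ} (hu : ContDiff ℝ 2 u)
    (hw : ContDiff ℝ 2 w) (hu0 : u t = 0) (hw0 : w t = 0) :
    iteratedDeriv 2 (fun s => u s * w s) t = 2 * (deriv u t * deriv w t) := by
  have := iteratedDeriv_fun_mul (n := 2) (x := t) hu.contDiffAt hw.contDiffAt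
  rw [this]
  simp [Finset.sum_range_succ, hu0, hw0, mul_assoc]

lemma iteratedDeriv_two_fObj {n d p : ℕ} (L : Matrix (Fin n × Fin d) (Fin n × Fin d) ℝ)
    {T : ℝ → Matrix (Fin p) (Fin n × Fin d) ℝ} {T' : Matrix (Fin p) (Fin n × Fin d) ℝ} {t : ℝ}
    (hT : ∀ a x, ContDiff ℝ 2 fun s => T s a x) (hT' : ∀ a x, deriv (fun s => T s a x) t = T' a x)
    (h0 : T t = 0) :
    iteratedDeriv 2 (fun s => fObj L (T s)) t = 2 * fObj L T' := by
  simp only [fObj_eq_sum, Finset.mul_sum]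
  have hc : ∀ x y a, ContDiff ℝ 2 fun s => L x y * (T s a y * T s a x) := fun x y a =>
    contDiff_const.mul ((hT a y).mul (hT a x))
  rw [iteratedDeriv_fun_sum fun x _ => ContDiff.contDiffAt <| ContDiff.sum fun y _ =>
    ContDiff.sum fun a _ => hc x y a]
  refine Finset.sum_congr rfl fun x _ => ?_
  rw [iteratedDeriv_fun_sum fun y _ => ContDiff.contDiffAt <| ContDiff.sum fun a _ => hc x y a]
  refine Finset.sum_congr rfl fun y _ => ?_
  rw [iteratedDeriv_fun_sum fun a _ => ContDiff.contDiffAt <| hc x y a]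
  refine Finset.sum_congr rfl fun a _ => ?_
  rw [iteratedDeriv_const_mul_field, iteratedDeriv_two_mul_of_eq_zero (hT a y) (hT a x)
    (by simp [h0]) (by simp [h0]), hT', hT']
  ring

lemma connLap_transpose {n d : ℕ} {E : Finset (Fin n × Fin n)} (hE : ∀ e ∈ E, e.1 < e.2)
    (κ : Fin n × Fin n → ℝ) (Rbar : Fin n × Fin n → Matrix (Fin d) (Fin d) ℝ) :
    (connLap E κ Rbar)ᵀ = connLap E κ Rbar := by
  ext ⟨i, a⟩ ⟨j, b⟩
  simp only [Matrix.transpose_apply, connLap]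
  by_cases hij : i = j
  · subst hij
    simp [eq_comm]
  · rw [if_neg hij, if_neg (Ne.symm hij)]
    by_cases h1 : (i, j) ∈ E <;> by_cases h2 : (j, i) ∈ E <;> simp only [h1, h2, if_true, if_false]
    exact absurd (hE _ h1) (lt_asymm (hE _ h2))

lemma certMat_transpose {n d p : ℕ} {L : Matrix (Fin n × Fin d) (Fin n × Fin d) ℝ}
    (hL : Lᵀ = L) (S : Matrix (Fin p) (Fin n × Fin d) ℝ) : (certMat L S)ᵀ = certMat L S := by
  have h : (L * (Sᵀ * S) + (Sᵀ * S) * L)ᵀ = L * (Sᵀ * S) + (Sᵀ * S) * L := by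
    simp only [Matrix.transpose_add, Matrix.transpose_mul, Matrix.transpose_transpose, hL]
    rw [add_comm]
  rw [certMat, Matrix.transpose_sub, hL, Matrix.transpose_smul]
  congr 2
  ext x y
  simp only [Matrix.transpose_apply, symBlockDiag, eq_comm (a := y.1)]
  rw [← Matrix.transpose_apply (_ + _), h]

lemma fObj_eq_fObj_certMat_add {n d p q : ℕ} (L : Matrix (Fin n × Fin d) (Fin n × Fin d) ℝ)
    (S : Matrix (Fin p) (Fin n × Fin d) ℝ) {T : Matrix (Fin q) (Fin n × Fin d) ℝ}
    (hT : StProdFeas T) :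
    fObj L T = fObj (certMat L S) T + (L - certMat L S).trace := by
  have key : ((L - certMat L S) * (Tᵀ * T)).trace = (L - certMat L S).trace := by
    simp only [Matrix.trace, Matrix.diag_apply]
    refine Finset.sum_congr rfl fun x _ => ?_
    rw [Matrix.mul_apply, Finset.sum_eq_single x]
    · have := congrFun (congrFun (hT x.1) x.2) x.2
      simp only [Matrix.mul_apply, Matrix.transpose_apply, blockCol, Matrix.one_apply_eq] at this
      simp [Matrix.mul_apply, this]
    · rintro y - hy
      by_cases hxy : x.1 = y.1
      · have := congrFun (congrFun (hT x.1) y.2) x.2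
        have hne : y.2 ≠ x.2 := fun h => hy (Prod.ext hxy.symm h)
        simp only [Matrix.mul_apply, Matrix.transpose_apply, blockCol, Matrix.one_apply_ne hne]
          at this
        rw [Matrix.mul_apply]
        simp only [Matrix.transpose_apply]
        rw [show y = (x.1, y.2) from Prod.ext hxy.symm rfl, this, mul_zero]
      · simp [certMat, symBlockDiag, hxy]
    · simp
  rw [← key, fObj, fObj, ← Matrix.trace_add, ← Matrix.add_mul, add_sub_cancel]

lemma fObj_sub_of_mul_eq_zero {n d p : ℕ} {C : Matrix (Fin n × Fin d) (Fin n × Fin d) ℝ}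
    (hC : Cᵀ = C) {S : Matrix (Fin p) (Fin n × Fin d) ℝ} (hS : S * C = 0)
    (T : Matrix (Fin p) (Fin n × Fin d) ℝ) : fObj C (T - S) = fObj C T := by
  have hS' : C * Sᵀ = 0 := by
    rw [← hC, ← Matrix.transpose_mul, hS, Matrix.transpose_zero]
  simp only [fObj, ← Matrix.mul_assoc]
  rw [Matrix.trace_mul_comm, Matrix.trace_mul_comm (C * Tᵀ)]
  rw [Matrix.transpose_sub, Matrix.mul_sub, hS', sub_zero, ← Matrix.mul_assoc, ← Matrix.mul_assoc,
    Matrix.sub_mul, hS, sub_zero]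

lemma Pmat_transpose_mul_self {d p : ℕ} (hdp : d ≤ p) : (Pmat d p)ᵀ * Pmat d p = 1 := by
  ext a b
  simp only [Matrix.mul_apply, Matrix.transpose_apply, Pmat]
  rw [Finset.sum_eq_single (Fin.castLE hdp a)]
  · simp [Matrix.one_apply, Fin.ext_iff]
  · intro c _ hc
    rw [if_neg fun h : (c : ℕ) = a => hc (Fin.ext h), zero_mul]
  · simp

lemma blockCol_bigProj {n d p : ℕ} (Q : Fin n → Matrix (Fin p) (Fin p) ℝ) (i : Fin n) :
    blockCol (bigProj (d := d) Q) i = Q i * Pmat d p := rfl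

lemma bigProj_feasible {n d p : ℕ} (hdp : d ≤ p) {Q : Fin n → Matrix (Fin p) (Fin p) ℝ}
    (hQ : ∀ i, Q i ∈ SOset p) : StProdFeas (bigProj (d := d) Q) := by
  intro i
  rw [blockCol_bigProj, StiefelSet, Set.mem_ofPred_eq, Matrix.transpose_mul, Matrix.mul_assoc,
    ← Matrix.mul_assoc (Q i)ᵀ, (hQ i).1, Matrix.one_mul, Pmat_transpose_mul_self hdp]

lemma contDiff_bigProj {n d p : ℕ} {γ : ℝ → Fin n → Matrix (Fin p) (Fin p) ℝ} {m : WithTop ℕ∞}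
    (hγ : ∀ i a b, ContDiff ℝ m fun t => γ t i a b) (a : Fin p) (x : Fin n × Fin d) :
    ContDiff ℝ m fun t => bigProj (γ t) a x := by
  simp only [bigProj, flatten, Matrix.mul_apply]
  exact ContDiff.sum fun c _ => (hγ _ _ _).mul contDiff_const

lemma hasDerivAt_bigProj {n d p : ℕ} {γ : ℝ → Fin n → Matrix (Fin p) (Fin p) ℝ}
    {γ' : Fin n → Matrix (Fin p) (Fin p) ℝ} {t : ℝ}
    (hγ : ∀ i a b, HasDerivAt (fun s => γ s i a b) (γ' i a b) t) (a : Fin p) (x : Fin n × Fin d) :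
    HasDerivAt (fun s => bigProj (γ s) a x) (bigProj γ' a x) t := by
  simp only [bigProj, flatten, Matrix.mul_apply]
  exact HasDerivAt.fun_sum fun c _ => (hγ _ _ _).mul_const _

lemma trace_transpose_mul_eq_sum_blockCol {n d p : ℕ} (M N : Matrix (Fin p) (Fin n × Fin d) ℝ) :
    (Mᵀ * N).trace = ∑ i, ((blockCol M i)ᵀ * blockCol N i).trace := by
  simp [Matrix.trace, Matrix.mul_apply, Fintype.sum_prod_type, blockCol]

/-- At a critical point, `P (SL)_iᵀ Q_i` is symmetric. -/
lemma IsCriticalSO.isSymm {n d p : ℕ} {L : Matrix (Fin n × Fin d) (Fin n × Fin d) ℝ}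
    (hL : Lᵀ = L) {Q : Fin n → Matrix (Fin p) (Fin p) ℝ} (hQ : ∀ i, Q i ∈ SOset p)
    (hcrit : IsCriticalSO L Q) (i : Fin n) :
    (Pmat d p * (blockCol (bigProj (d := d) Q * L) i)ᵀ * Q i).IsSymm := by
  have main : ∀ A : Matrix (Fin p) (Fin p) ℝ, Aᵀ = -A →
      (Pmat d p * (blockCol (bigProj (d := d) Q * L) i)ᵀ * Q i * A).trace = 0 := by
    intro A hA
    set B : Fin n → Matrix (Fin p) (Fin p) ℝ := Pi.single i A
    have hB : ∀ j, (B j)ᵀ = -B j := by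
      intro j
      obtain rfl | hj := eq_or_ne j i
      · simp [B, hA]
      · simp [B, hj]
    have h0 := hcrit (rotCurve Q B) (contDiff_rotCurve Q B 1) (rotCurve_mem hQ hB)
      (rotCurve_zero Q B)
    have h1 := hasDerivAt_fObj hL (hasDerivAt_bigProj (d := d)
      (γ' := fun j => Q j * B j) (hasDerivAt_rotCurve Q B))
    rw [h1.deriv, rotCurve_zero, trace_transpose_mul_eq_sum_blockCol,
      Finset.sum_eq_single i] at h0
    · rw [blockCol_bigProj, ← Matrix.mul_assoc, Matrix.trace_mul_comm] at h0
      simpa [B, Matrix.mul_assoc] using h0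
    · intro j _ hj
      simp [blockCol_bigProj, B, hj]
    · simp
  ext a b
  have h := main (Matrix.single a b 1 - Matrix.single b a 1) (by simp)
  rw [Matrix.mul_sub, Matrix.trace_sub, Matrix.trace_mul_single, Matrix.trace_mul_single] at h
  simpa [sub_eq_zero] using h

lemma IsCriticalSO.bigProj_mul_certMat {n d p : ℕ} (hdp : d ≤ p)
    {L : Matrix (Fin n × Fin d) (Fin n × Fin d) ℝ}
    (hL : Lᵀ = L) {Q : Fin n → Matrix (Fin p) (Fin p) ℝ} (hQ : ∀ i, Q i ∈ SOset p)
    (hcrit : IsCriticalSO L Q) : bigProj (d := d) Q * certMat L (bigProj Q) = 0 := by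
  set S : Matrix (Fin p) (Fin n × Fin d) ℝ := bigProj Q with hSdef
  have hstat : ∀ i, blockCol (S * L) i = blockCol S i * ((blockCol S i)ᵀ * blockCol (S * L) i)
      ∧ ((blockCol S i)ᵀ * blockCol (S * L) i).IsSymm := by
    intro i
    have hs := hcrit.isSymm hL hQ i
    rw [← hSdef] at hs
    have hQQ : Q i * (Q i)ᵀ = 1 := mul_eq_one_comm.1 (hQ i).1
    have hSi : blockCol S i = Q i * Pmat d p := rfl
    have hPP := Pmat_transpose_mul_self hdp
    generalize blockCol (S * L) i = G at hs
    rw [hSi]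
    have hM : (Q i)ᵀ * G * (Pmat d p)ᵀ = Pmat d p * Gᵀ * Q i := by
      rw [← hs.eq]
      simp [Matrix.mul_assoc]
    have hsym : (Pmat d p)ᵀ * (Q i)ᵀ * G = Gᵀ * Q i * Pmat d p := by
      calc (Pmat d p)ᵀ * (Q i)ᵀ * G
          = (Pmat d p)ᵀ * ((Q i)ᵀ * G * (Pmat d p)ᵀ) * Pmat d p := by
            simp only [Matrix.mul_assoc, hPP, Matrix.mul_one]
        _ = ((Pmat d p)ᵀ * Pmat d p) * (Gᵀ * Q i * Pmat d p) := by
            rw [hM]; simp only [Matrix.mul_assoc]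
        _ = _ := by rw [hPP, Matrix.one_mul]
    rw [Matrix.transpose_mul, hsym]
    constructor
    · calc G = (Q i * (Q i)ᵀ) * G * ((Pmat d p)ᵀ * Pmat d p) := by
            rw [hQQ, hPP, Matrix.one_mul, Matrix.mul_one]
        _ = Q i * ((Q i)ᵀ * G * (Pmat d p)ᵀ) * Pmat d p := by simp only [Matrix.mul_assoc]
        _ = _ := by rw [hM]; simp only [Matrix.mul_assoc]
    · rw [Matrix.IsSymm, ← hsym]
      simp [Matrix.mul_assoc, ← hsym]
  have hblock : ∀ i b c, (L * (Sᵀ * S) + (Sᵀ * S) * L) (i, b) (i, c) =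
      2 * ((blockCol S i)ᵀ * blockCol (S * L) i) b c := by
    intro i b c
    have e : ∀ b c, ((Sᵀ * S) * L) (i, b) (i, c) =
        ((blockCol S i)ᵀ * blockCol (S * L) i) b c := by
      intro b c
      rw [Matrix.mul_assoc]
      simp [Matrix.mul_apply, blockCol]
    have e' : L * (Sᵀ * S) = ((Sᵀ * S) * L)ᵀ := by simp [hL]
    rw [Matrix.add_apply, e', Matrix.transpose_apply, e, e, two_mul, (hstat i).2.apply]
  ext a ⟨i, c⟩
  have h1 := congrFun (congrFun (hstat i).1 a) c
  rw [certMat, Matrix.mul_sub, Matrix.sub_apply]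
  have h2 : (S * ((1 / 2 : ℝ) • symBlockDiag (L * (Sᵀ * S) + (Sᵀ * S) * L))) a (i, c) =
      (blockCol S i * ((blockCol S i)ᵀ * blockCol (S * L) i)) a c := by
    rw [Matrix.mul_apply, Fintype.sum_prod_type, Finset.sum_eq_single i, Matrix.mul_apply]
    · refine Finset.sum_congr rfl fun b _ => ?_
      simp only [Matrix.smul_apply, symBlockDiag, if_true, hblock, smul_eq_mul]
      simp only [blockCol]
      ring
    · intro j _ hj
      simp [symBlockDiag, hj]
    · simp
  rw [h2, ← h1]
  simp [blockCol]

lemma deriv_fObj_eq_zero {n d p q : ℕ} (hdp : d ≤ p)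
    {L : Matrix (Fin n × Fin d) (Fin n × Fin d) ℝ} (hL : Lᵀ = L)
    (S : Matrix (Fin q) (Fin n × Fin d) ℝ) {γ : ℝ → Fin n → Matrix (Fin p) (Fin p) ℝ}
    (hγ : ∀ i a b, DifferentiableAt ℝ (fun t => γ t i a b) 0) (hmem : ∀ t i, γ t i ∈ SOset p)
    (h0 : bigProj (d := d) (γ 0) * certMat L S = 0) :
    deriv (fun t => fObj L (bigProj (γ t))) 0 = 0 := by
  simp only [fun t => fObj_eq_fObj_certMat_add L S (bigProj_feasible hdp (hmem t))]
  have h := hasDerivAt_fObj (certMat_transpose hL S) (hasDerivAt_bigProj (d := d)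
    (γ' := fun i => Matrix.of fun a b => deriv (fun t => γ t i a b) 0)
    fun i a b => (hγ i a b).hasDerivAt)
  rw [deriv_add_const, h.deriv, h0]
  simp

lemma iteratedDeriv_two_fObj_bigProj {n d p q : ℕ} (hdp : d ≤ p)
    {L : Matrix (Fin n × Fin d) (Fin n × Fin d) ℝ} (hL : Lᵀ = L)
    (S : Matrix (Fin q) (Fin n × Fin d) ℝ) {γ : ℝ → Fin n → Matrix (Fin p) (Fin p) ℝ}
    {γ' : Fin n → Matrix (Fin p) (Fin p) ℝ}
    (hγ : ∀ i a b, ContDiff ℝ 2 fun t => γ t i a b)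
    (hγ' : ∀ i a b, HasDerivAt (fun t => γ t i a b) (γ' i a b) 0)
    (hmem : ∀ t i, γ t i ∈ SOset p) (h0 : bigProj (d := d) (γ 0) * certMat L S = 0) :
    iteratedDeriv 2 (fun t => fObj L (bigProj (γ t))) 0 =
      2 * fObj (certMat L S) (bigProj γ') := by
  have e : (fun t => fObj L (bigProj (γ t))) = fun t =>
      (L - certMat L S).trace + fObj (certMat L S) (bigProj (γ t) - bigProj (γ 0)) := by
    funext t
    rw [fObj_sub_of_mul_eq_zero (certMat_transpose hL S) h0,
      fObj_eq_fObj_certMat_add L S (bigProj_feasible hdp (hmem t)), add_comm]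
  rw [e, iteratedDeriv_const_add (by norm_num)]
  refine iteratedDeriv_two_fObj _ (fun a x => ?_) (fun a x => ?_) (sub_self _)
  · exact (contDiff_bigProj hγ a x).sub contDiff_const
  · exact ((hasDerivAt_bigProj hγ' a x).sub_const _).deriv

lemma padRot_eq_submatrix {p : ℕ} (Q : Matrix (Fin p) (Fin p) ℝ) :
    padRot Q = (Matrix.fromBlocks Q 0 0 (1 : Matrix (Fin 1) (Fin 1) ℝ)).submatrix
      finSumFinEquiv.symm finSumFinEquiv.symm := by
  ext a b
  obtain ⟨a, rfl⟩ := finSumFinEquiv.surjective a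
  obtain ⟨b, rfl⟩ := finSumFinEquiv.surjective b
  rcases a with a | a <;> rcases b with b | b <;>
    simp [padRot, Fin.fin_one_eq_zero]

lemma padRot_mem {p : ℕ} {Q : Matrix (Fin p) (Fin p) ℝ} (hQ : Q ∈ SOset p) :
    padRot Q ∈ SOset (p + 1) := by
  rw [padRot_eq_submatrix]
  refine ⟨?_, ?_⟩
  · rw [Matrix.transpose_submatrix, Matrix.submatrix_mul_equiv, Matrix.fromBlocks_transpose,
      Matrix.fromBlocks_multiply]
    simp [hQ.1]
  · rw [Matrix.det_submatrix_equiv_self, Matrix.det_fromBlocks_zero₂₁, hQ.2]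
    simp

lemma skewFromVec_transpose {p : ℕ} (w : Fin p → ℝ) : (skewFromVec w)ᵀ = -skewFromVec w := by
  ext a b
  simp only [Matrix.transpose_apply, Matrix.neg_apply, skewFromVec]
  split_ifs <;> simp

lemma Pmat_castSucc {d p : ℕ} (a : Fin p) (b : Fin d) :
    Pmat d (p + 1) a.castSucc b = Pmat d p a b := rfl

lemma Pmat_last {d p : ℕ} (hdp : d ≤ p) (b : Fin d) : Pmat d (p + 1) (Fin.last p) b = 0 :=
  if_neg (by simp; omega)

lemma bigProj_padRot_castSucc {n d p : ℕ} (Q : Fin n → Matrix (Fin p) (Fin p) ℝ)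
    (a : Fin p) (x : Fin n × Fin d) :
    bigProj (fun i => padRot (Q i)) a.castSucc x = bigProj Q a x := by
  simp [bigProj, flatten, Matrix.mul_apply, Fin.sum_univ_castSucc, Pmat_castSucc, padRot]

lemma bigProj_padRot_last {n d p : ℕ} (hdp : d ≤ p) (Q : Fin n → Matrix (Fin p) (Fin p) ℝ)
    (x : Fin n × Fin d) :
    bigProj (fun i => padRot (Q i)) (Fin.last p) x = 0 := by
  simp [bigProj, flatten, Matrix.mul_apply, Fin.sum_univ_castSucc, Pmat_last hdp, padRot]

lemma bigProj_padRot_mul_eq_zero {n d p : ℕ} (hdp : d ≤ p)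
    {Q : Fin n → Matrix (Fin p) (Fin p) ℝ} {C : Matrix (Fin n × Fin d) (Fin n × Fin d) ℝ}
    (h : bigProj (d := d) Q * C = 0) : bigProj (d := d) (fun i => padRot (Q i)) * C = 0 := by
  ext a x
  refine Fin.lastCases ?_ (fun a => ?_) a
  · simp [Matrix.mul_apply, bigProj_padRot_last hdp]
  · have := congrFun (congrFun h a) x
    simpa [Matrix.mul_apply, bigProj_padRot_castSucc] using this

lemma bigProj_padRot_mul_skew_castSucc {n d p : ℕ} (hdp : d ≤ p)
    (Q : Fin n → Matrix (Fin p) (Fin p) ℝ) (w : Fin n → Fin p → ℝ)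
    (a : Fin p) (x : Fin n × Fin d) :
    bigProj (fun i => padRot (Q i) * skewFromVec (w i)) a.castSucc x = 0 := by
  simp [bigProj, flatten, Matrix.mul_apply, Fin.sum_univ_castSucc, Pmat_last hdp, padRot,
    skewFromVec]

lemma bigProj_padRot_mul_skew_last {n d p : ℕ} (hdp : d ≤ p)
    (Q : Fin n → Matrix (Fin p) (Fin p) ℝ) (v : Fin n × Fin d → ℝ) (x : Fin n × Fin d) :
    bigProj (fun i => padRot (Q i) * skewFromVec (padVec p fun c => v (i, c))) (Fin.last p) x =
      v x := by
  simp only [bigProj, flatten, Matrix.mul_apply, Fin.sum_univ_castSucc, Pmat_last hdp, padRot,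
    skewFromVec, Pmat_castSucc]
  simp only [Fin.val_castSucc, Fin.val_last, Fin.is_lt, lt_irrefl, dite_true, dite_false, if_true,
    if_false, zero_mul, Finset.sum_const_zero, zero_add, one_mul, mul_zero, add_zero]
  rw [Finset.sum_eq_single (Fin.castLE hdp x.2)]
  · simp [padVec, Pmat]
  · intro c _ hc
    rw [Pmat, if_neg fun h : (c : ℕ) = x.2 => hc (Fin.ext h), mul_zero]
  · simp

lemma fObj_of_last_row {n d p : ℕ} (C : Matrix (Fin n × Fin d) (Fin n × Fin d) ℝ)
    {S : Matrix (Fin (p + 1)) (Fin n × Fin d) ℝ} {v : Fin n × Fin d → ℝ}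
    (h0 : ∀ a x, S (Fin.castSucc a) x = 0) (hv : ∀ x, S (Fin.last p) x = v x) :
    fObj C S = v ⬝ᵥ C *ᵥ v := by
  rw [fObj_eq_sum]
  simp only [Fin.sum_univ_castSucc, h0, hv, dotProduct, Matrix.mulVec, Finset.mul_sum]
  refine Finset.sum_congr rfl fun x _ => Finset.sum_congr rfl fun y _ => ?_
  simp
  ring

/-- Saddle escape on `SO(p)^n`: a first-order critical point of `g` with a
negative certificate eigenvalue lifts to a first-order critical point of `g` on `SO(p+1)^n`
admitting a second-order descent direction. -/
theorem statement9 {n d p : ℕ} (hn : 1 ≤ n) (hd : 1 ≤ d) (hdp : d ≤ p)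
    (E : Finset (Fin n × Fin n)) (hE : ∀ e ∈ E, e.1 < e.2)
    (κ : Fin n × Fin n → ℝ) (hκ : ∀ e ∈ E, 0 ≤ κ e)
    (Rbar : Fin n × Fin n → Matrix (Fin d) (Fin d) ℝ)
    (hRbar : ∀ e ∈ E, Rbar e ∈ SOset d)
    (Qstar : Fin n → Matrix (Fin p) (Fin p) ℝ) (hQ : ∀ i, Qstar i ∈ SOset p)
    (hcrit : IsCriticalSO (connLap E κ Rbar) Qstar)
    (lam : ℝ) (hneg : lam < 0) (v : Fin n × Fin d → ℝ) (hv : v ≠ 0)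
    (heig : certMat (connLap E κ Rbar) (bigProj Qstar) *ᵥ v = lam • v)
    (hmin : ∀ (μ : ℝ) (w : Fin n × Fin d → ℝ), w ≠ 0 →
      certMat (connLap E κ Rbar) (bigProj Qstar) *ᵥ w = μ • w → lam ≤ μ) :
    IsCriticalSO (connLap E κ Rbar) (fun i => padRot (Qstar i)) ∧
    ∃ γ : ℝ → (Fin n → Matrix (Fin (p + 1)) (Fin (p + 1)) ℝ),
      (∀ i a b, ContDiff ℝ 2 fun t => γ t i a b) ∧
      (∀ t i, γ t i ∈ SOset (p + 1)) ∧
      γ 0 = (fun i => padRot (Qstar i)) ∧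
      (∀ i a b, deriv (fun t => γ t i a b) 0 =
        (padRot (Qstar i) * skewFromVec (padVec p (fun c => v (i, c)))) a b) ∧
      deriv (fun t => fObj (connLap E κ Rbar) (bigProj (γ t))) 0 = 0 ∧
      iteratedDeriv 2 (fun t => fObj (connLap E κ Rbar) (bigProj (γ t))) 0 < 0 := by
  have hL := connLap_transpose hE κ Rbar
  have hdp' : d ≤ p + 1 := hdp.trans p.le_succ
  have hQpad : ∀ i, padRot (Qstar i) ∈ SOset (p + 1) := fun i => padRot_mem (hQ i)
  have hstat := bigProj_padRot_mul_eq_zero hdp (hcrit.bigProj_mul_certMat hdp hL hQ)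
  have hfirst : IsCriticalSO (connLap E κ Rbar) (fun i => padRot (Qstar i)) := by
    intro γ hγ hmem h0
    exact deriv_fObj_eq_zero hdp' hL (bigProj Qstar)
      (fun i a b => (hγ i a b).differentiable (by norm_num) 0) hmem (by rw [h0, hstat])
  set A : Fin n → Matrix (Fin (p + 1)) (Fin (p + 1)) ℝ :=
    fun i => skewFromVec (padVec p fun c => v (i, c))
  set γ := rotCurve (fun i => padRot (Qstar i)) A
  have hγ0 : γ 0 = fun i => padRot (Qstar i) := rotCurve_zero _ _
  have hmem : ∀ t i, γ t i ∈ SOset (p + 1) :=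
    rotCurve_mem hQpad fun i => skewFromVec_transpose _
  have hderiv := hasDerivAt_rotCurve (fun i => padRot (Qstar i)) A
  refine ⟨hfirst, γ, contDiff_rotCurve _ _ 2, hmem, hγ0, fun i a b => (hderiv i a b).deriv,
    hfirst γ (contDiff_rotCurve _ _ 1) hmem hγ0, ?_⟩
  rw [iteratedDeriv_two_fObj_bigProj hdp' hL (bigProj Qstar) (contDiff_rotCurve _ _ 2) hderiv
    hmem (by rw [rotCurve_zero, hstat]), fObj_of_last_row _ (bigProj_padRot_mul_skew_castSucc hdp Qstar _)
    (bigProj_padRot_mul_skew_last hdp Qstar v), heig, dotProduct_smul, smul_eq_mul]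
  have hpos : 0 < v ⬝ᵥ v := by
    obtain ⟨x, hx⟩ := Function.ne_iff.1 hv
    exact Finset.sum_pos' (fun y _ => mul_self_nonneg _)
      ⟨x, Finset.mem_univ x, mul_self_pos.2 hx⟩
  nlinarith [mul_neg_of_neg_of_pos hneg hpos]
end
end
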